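/- arXiv:1605.02899 — 3 statements merged into one kernel-verified Lean document; each statement's English description precedes it below -/
import Mathlib

section
/- Let n_t, T be positive integers and let A, B ∈ ℂ^{n_t×T} be two weight matrices satisfying the symmetrized trace conditions. Then for every number of receive antennas n_r and every channel matrix H ∈ ℂ^{n_r×n_t}, the realified vectorizations of HA and HB are orthogonal: ⟨ṽec(HA), ṽec(HB)⟩ = 0. In particular, the corresponding two columns of the equivalent channel matrix H_eq are orthogonal for every H and every n_r, so this orthogonality depends only on the weight matrices and not on the channel gains or the number of receive antennas. -/
open Matrix Complex
open scoped RealInnerProductSpace ComplexConjugate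

/-- Realified (column-stacked) vectorization of a complex matrix:
index `(l, (i, s))` holds the real part (`s = 0`) or imaginary part (`s = 1`)
of the entry in row `i` of the `l`-th column. -/
noncomputable def tvec {m n : ℕ} (X : Matrix (Fin m) (Fin n) ℂ) :
    EuclideanSpace ℝ (Fin n × Fin m × Fin 2) :=
  WithLp.toLp 2 fun p => if p.2.2 = 0 then (X p.2.1 p.1).re else (X p.2.1 p.1).im

/-- The Euclidean inner product of realified vectorizations is the real Frobenius inner product. -/
lemma inner_tvec {m n : ℕ} (X Y : Matrix (Fin m) (Fin n) ℂ) :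
    ⟪tvec X, tvec Y⟫ = (X * Yᴴ).trace.re := by
  simp only [tvec, PiLp.inner_apply, Fintype.sum_prod_type, Fin.sum_univ_two, Matrix.trace,
    Matrix.diag_apply, Matrix.mul_apply, Matrix.conjTranspose_apply, Complex.re_sum]
  rw [Finset.sum_comm]
  refine Finset.sum_congr rfl fun i _ => Finset.sum_congr rfl fun l _ => ?_
  simp
  ring

/-- Congruence preserves skew-Hermitian matrices, whose trace is purely imaginary. -/
lemma re_trace_mul_mul_conjTranspose_eq_zero {m n : Type*} [Fintype m] [Fintype n]
    {M : Matrix n n ℂ} (hM : Mᴴ = -M) (H : Matrix m n ℂ) : (H * M * Hᴴ).trace.re = 0 := by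
  have h := congrArg Complex.re (Matrix.trace_conjTranspose (H * M * Hᴴ))
  simp only [Matrix.conjTranspose_mul, Matrix.conjTranspose_conjTranspose, hM, Matrix.neg_mul,
    Matrix.mul_neg, Matrix.trace_neg, Complex.neg_re, ← Matrix.mul_assoc, Complex.star_def,
    Complex.conj_re] at h
  linarith

/-- The symmetrized trace conditions say that `A * Bᴴ` is skew-Hermitian. -/
lemma conjTranspose_mul_conjTranspose_eq_neg {n ι : Type*} [LinearOrder n] [Fintype ι]
    (A B : Matrix n ι ℂ)
    (h1 : ∀ q p : n, q ≤ p →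
      ∑ l, (A q l * conj (B p l) + A p l * conj (B q l)).re = 0)
    (h2 : ∀ q p : n, q < p →
      ∑ l, (Complex.I * (A q l * conj (B p l) - A p l * conj (B q l))).re = 0) :
    (A * Bᴴ)ᴴ = -(A * Bᴴ) := by
  have hre (q p : n) (h : q ≤ p) : ((A * Bᴴ) q p).re + ((A * Bᴴ) p q).re = 0 := by
    simpa only [Matrix.mul_apply, Matrix.conjTranspose_apply, Complex.re_sum, Complex.add_re,
      Finset.sum_add_distrib, Complex.star_def] using h1 q p h
  have him (q p : n) (h : q < p) : ((A * Bᴴ) q p).im = ((A * Bᴴ) p q).im := by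
    have := h2 q p h
    simp only [Complex.I_mul_re, Complex.sub_im, Finset.sum_neg_distrib,
      Finset.sum_sub_distrib] at this
    simp only [Matrix.mul_apply, Matrix.conjTranspose_apply, Complex.im_sum, Complex.star_def]
    linarith
  ext q p
  rw [Matrix.conjTranspose_apply, Matrix.neg_apply, Complex.star_def]
  apply Complex.ext
  · rw [Complex.conj_re, Complex.neg_re]
    rcases le_total q p with h | h <;> linarith [hre _ _ h]
  · rw [Complex.conj_im, Complex.neg_im]
    rcases lt_trichotomy q p with h | rfl | h
    · rw [him _ _ h]
    · rfl
    · rw [him _ _ h]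

/-- if two weight matrices `A, B ∈ ℂ^{n_t×T}` satisfy the symmetrized trace
conditions, then for every number of receive antennas `n_r` and every channel matrix `H`,
the realified vectorizations of `H*A` and `H*B` (the corresponding columns of the
equivalent channel matrix) are orthogonal — independently of `H` and `n_r`. -/
theorem stmt0 (nt T : ℕ) (hnt : 0 < nt) (hT : 0 < T)
    (A B : Matrix (Fin nt) (Fin T) ℂ)
    (h1 : ∀ q p : Fin nt, q ≤ p →
      ∑ l : Fin T, (A q l * conj (B p l) + A p l * conj (B q l)).re = 0)
    (h2 : ∀ q p : Fin nt, q < p →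
      ∑ l : Fin T, (Complex.I * (A q l * conj (B p l) - A p l * conj (B q l))).re = 0) :
    ∀ (nr : ℕ) (H : Matrix (Fin nr) (Fin nt) ℂ),
      ⟪tvec (H * A), tvec (H * B)⟫ = 0 := by
  intro nr H
  have h := re_trace_mul_mul_conjTranspose_eq_zero
    (conjTranspose_mul_conjTranspose_eq_neg A B h1 h2) H
  rwa [inner_tvec, Matrix.conjTranspose_mul, ← Matrix.mul_assoc, Matrix.mul_assoc H A]
end

section
/- Let v_1, …, v_N be vectors in a real inner product space and let c : {1,…,N} → {1,…,g} be an assignment of each index to one of g groups such that ⟨v_i, v_j⟩ = 0 whenever c(i) ≠ c(j). Let r_1, …, r_N be the (unnormalized) Gram–Schmidt orthogonalization of v_1, …, v_N. Then for every i, the vector r_i lies in the linear span of { v_k : k ≤ i, c(k) = c(i) }, and consequently ⟨r_i, v_j⟩ = 0 whenever c(i) ≠ c(j). -/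
open scoped RealInnerProductSpace

instance finWFLT (N : ℕ) : WellFoundedLT (Fin N) := inferInstance

section GroupedGramSchmidt

open InnerProductSpace

variable {𝕜 E ι γ : Type*} [RCLike 𝕜] [NormedAddCommGroup E] [InnerProductSpace 𝕜 E]

theorem inner_eq_zero_of_mem_span_image {v : ι → E} {s : Set ι} {x y : E}
    (hx : x ∈ Submodule.span 𝕜 (v '' s)) (h : ∀ k ∈ s, inner 𝕜 (v k) y = 0) :
    inner 𝕜 x y = 0 := by
  induction hx using Submodule.span_induction with
  | mem x hx =>
    obtain ⟨k, hk, rfl⟩ := hx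
    exact h k hk
  | zero => exact inner_zero_left y
  | add a b _ _ ha hb => rw [inner_add_left, ha, hb, add_zero]
  | smul t a _ ha => rw [inner_smul_left, ha, mul_zero]

theorem gramSchmidt_mem_span_of_orthogonal_groups [LinearOrder ι] [LocallyFiniteOrderBot ι]
    [WellFoundedLT ι] {v : ι → E} {c : ι → γ}
    (h : ∀ i j, c i ≠ c j → inner 𝕜 (v i) (v j) = 0) (i : ι) :
    gramSchmidt 𝕜 v i ∈ Submodule.span 𝕜 (v '' {k | k ≤ i ∧ c k = c i}) := by
  induction i using WellFoundedLT.induction with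
  | ind i ih =>
    rw [gramSchmidt_def]
    refine Submodule.sub_mem _ (Submodule.subset_span ⟨i, ⟨le_rfl, rfl⟩, rfl⟩)
      (Submodule.sum_mem _ fun k hk => ?_)
    have hki : k < i := Finset.mem_Iio.1 hk
    rw [Submodule.starProjection_singleton]
    by_cases hc : c k = c i
    · refine Submodule.smul_mem _ _ (Submodule.span_mono (Set.image_mono ?_) (ih k hki))
      exact fun l hl => ⟨hl.1.trans hki.le, hl.2.trans hc⟩
    · rw [inner_eq_zero_of_mem_span_image (ih k hki) fun l hl => h l i (hl.2.trans_ne hc),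
        zero_div, zero_smul]
      exact Submodule.zero_mem _

end GroupedGramSchmidt

/-- if `⟨v_i, v_j⟩ = 0` whenever the indices lie in different groups, then
each Gram–Schmidt vector `r_i` lies in the span of the earlier vectors of its own group,
and consequently `⟨r_i, v_j⟩ = 0` whenever `c(i) ≠ c(j)`. -/
theorem stmt12 {E : Type*} [NormedAddCommGroup E] [InnerProductSpace ℝ E]
    (N g : ℕ) (v : Fin N → E) (c : Fin N → Fin g)
    (h : ∀ i j : Fin N, c i ≠ c j → ⟪v i, v j⟫ = 0) :
    (∀ i : Fin N,
      InnerProductSpace.gramSchmidt ℝ v i ∈ Submodule.span ℝ (v '' {k | k ≤ i ∧ c k = c i})) ∧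
    (∀ i j : Fin N, c i ≠ c j → ⟪InnerProductSpace.gramSchmidt ℝ v i, v j⟫ = 0) := by
  have hspan := gramSchmidt_mem_span_of_orthogonal_groups h
  exact ⟨hspan, fun i j hij =>
    inner_eq_zero_of_mem_span_image (hspan i) fun k hk => h k j (hk.2.trans_ne hij)⟩
end

section
/- (Zero structure for the Golden code.) Let θ = (1+√5)/2, θ̄ = (1−√5)/2, α = 1 + i − i·θ, ᾱ = 1 + i − i·θ̄, e = [[0,1],[i,0]] ∈ ℂ^{2×2}, and define the eight weight matrices A_1 = diag(α, ᾱ), A_2 = i·diag(α, ᾱ), A_3 = diag(α·θ, ᾱ·θ̄), A_4 = i·diag(α·θ, ᾱ·θ̄), A_5 = A_1·e, A_6 = A_2·e, A_7 = A_3·e, A_8 = A_4·e. Then for every number of receive antennas n_r and every channel matrix H ∈ ℂ^{n_r×2}, one has ⟨ṽec(H·A_i), ṽec(H·A_j)⟩ = 0 for every pair (i,j) ∈ {(1,2), (1,4), (2,3), (3,4), (5,6), (5,8), (6,7), (7,8)}; i.e. these pairs of columns of the equivalent channel matrix of the Golden code are orthogonal for every H and n_r. -/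
open Matrix Complex
open scoped RealInnerProductSpace

noncomputable def gcθ : ℝ := (1 + Real.sqrt 5) / 2
noncomputable def gcθb : ℝ := (1 - Real.sqrt 5) / 2
noncomputable def gcα : ℂ := 1 + Complex.I - Complex.I * (gcθ : ℂ)
noncomputable def gcαb : ℂ := 1 + Complex.I - Complex.I * (gcθb : ℂ)
noncomputable def gce : Matrix (Fin 2) (Fin 2) ℂ := !![0, 1; Complex.I, 0]

/-- The eight weight matrices of the Golden code (0-based indexing). -/
noncomputable def gcA : Fin 8 → Matrix (Fin 2) (Fin 2) ℂ
  | 0 => !![gcα, 0; 0, gcαb]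
  | 1 => Complex.I • !![gcα, 0; 0, gcαb]
  | 2 => !![gcα * (gcθ : ℂ), 0; 0, gcαb * (gcθb : ℂ)]
  | 3 => Complex.I • !![gcα * (gcθ : ℂ), 0; 0, gcαb * (gcθb : ℂ)]
  | 4 => !![gcα, 0; 0, gcαb] * gce
  | 5 => (Complex.I • !![gcα, 0; 0, gcαb]) * gce
  | 6 => !![gcα * (gcθ : ℂ), 0; 0, gcαb * (gcθb : ℂ)] * gce
  | 7 => (Complex.I • !![gcα * (gcθ : ℂ), 0; 0, gcαb * (gcθb : ℂ)]) * gce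

theorem inner_tvec_eq_zero {m n : ℕ} {X Y : Matrix (Fin m) (Fin n) ℂ}
    (h : ∀ k l, (X k l).re * (Y k l).re + (X k l).im * (Y k l).im = 0) :
    ⟪tvec X, tvec Y⟫ = 0 := by
  simp only [tvec, PiLp.inner_apply, Fintype.sum_prod_type, Fin.sum_univ_two]
  refine Finset.sum_eq_zero fun l _ => Finset.sum_eq_zero fun k _ => ?_
  simpa [mul_comm] using h k l

/-- zero structure for the Golden code: for every `n_r` and every channel
matrix `H ∈ ℂ^{n_r×2}`, the pairs of columns of the equivalent channel matrix indexed
(1-based) by `(1,2), (1,4), (2,3), (3,4), (5,6), (5,8), (6,7), (7,8)` are orthogonal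
(below, 0-based pairs). -/
theorem stmt19 :
    ∀ (nr : ℕ) (H : Matrix (Fin nr) (Fin 2) ℂ) (i j : Fin 8),
      (i, j) ∈ ({(0, 1), (0, 3), (1, 2), (2, 3), (4, 5), (4, 7), (5, 6), (6, 7)} :
        Set (Fin 8 × Fin 8)) →
      ⟪tvec (H * gcA i), tvec (H * gcA j)⟫ = 0 := by
  intro nr H i j hij
  simp only [Set.mem_insert_iff, Set.mem_singleton_iff, Prod.mk.injEq] at hij
  apply inner_tvec_eq_zero
  intro k l
  rcases hij with ⟨rfl, rfl⟩ | ⟨rfl, rfl⟩ | ⟨rfl, rfl⟩ | ⟨rfl, rfl⟩ | ⟨rfl, rfl⟩ | ⟨rfl, rfl⟩ |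
    ⟨rfl, rfl⟩ | ⟨rfl, rfl⟩ <;> fin_cases l <;>
    simp [gcA, gce, Matrix.mul_apply, Fin.sum_univ_two] <;> ring
end
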